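/- arXiv:1002.0497 — 2 statements merged into one kernel-verified Lean document; each statement's English description precedes it below -/
import Mathlib

section
/- For every complex z with Re z > 0, the integral ∫_{−∞}^{∞} e^{zt}·Ai(t) dt converges absolutely and equals e^{z³/3}. -/
open MeasureTheory ProbabilityTheory Complex Filter Topology

noncomputable section

/-- The Airy function `Ai`, defined via the contour-integral representation
`Ai(z) = (2π)⁻¹ ∫_ℝ exp((σ+it)³/3 − z(σ+it)) dt` with `σ = 1`. -/
def Ai (z : ℂ) : ℂ :=
  ((2 * Real.pi : ℝ) : ℂ)⁻¹ *
    ∫ t : ℝ, Complex.exp ((1 + t * Complex.I) ^ 3 / 3 - z * (1 + t * Complex.I))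

/-- The integrand as a function of a complex variable. -/
def airyK (x : ℝ) (s : ℂ) : ℂ := Complex.exp (s ^ 3 / 3 - x * s)

lemma airyK_norm (x σ t : ℝ) :
    ‖airyK x (σ + t * I)‖ = Real.exp (σ ^ 3 / 3 - σ * t ^ 2 - x * σ) := by
  rw [airyK, Complex.norm_exp]
  congr 1
  have : ((σ : ℂ) + t * I) ^ 3 / 3 - x * (σ + t * I)
      = ((σ ^ 3 / 3 - σ * t ^ 2 - x * σ : ℝ) : ℂ)
        + ((σ ^ 2 * t - t ^ 3 / 3 - x * t : ℝ) : ℂ) * I := by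
    have h3 : I ^ 3 = -I := by rw [pow_succ, I_sq]; ring
    push_cast
    ring_nf
    rw [h3, I_sq]
    ring
  rw [this]
  simp [-ofReal_sub, -ofReal_mul, -ofReal_div, -ofReal_pow]

lemma airyK_diff (x : ℝ) : Differentiable ℂ (airyK x) := by
  unfold airyK
  fun_prop

lemma airyK_cont (x σ : ℝ) : Continuous (fun t : ℝ => airyK x (σ + t * I)) :=
  (airyK_diff x).continuous.comp (by fun_prop)

lemma airyK_norm' (x σ t : ℝ) :
    ‖airyK x (σ + t * I)‖ = Real.exp (σ ^ 3 / 3 - x * σ) * Real.exp (-σ * t ^ 2) := by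
  rw [airyK_norm, ← Real.exp_add]
  congr 1
  ring

lemma airyK_int (x σ : ℝ) (hσ : 0 < σ) : Integrable (fun t : ℝ => airyK x (σ + t * I)) := by
  refine Integrable.mono' ((integrable_exp_neg_mul_sq hσ).const_mul
    (Real.exp (σ ^ 3 / 3 - x * σ))) (airyK_cont x σ).aestronglyMeasurable ?_
  filter_upwards with t
  rw [airyK_norm']

lemma airy_horiz (x σ τ T : ℝ) (hσ : 0 < σ) (h : σ ≤ τ) :
    ‖∫ s : ℝ in σ..τ, airyK x (s + T * I)‖
      ≤ Real.exp (τ ^ 3 / 3 + |x| * τ) * Real.exp (-σ * T ^ 2) * |τ - σ| := by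
  apply intervalIntegral.norm_integral_le_of_norm_le_const
  intro s hs
  rw [Set.uIoc_of_le h] at hs
  rw [airyK_norm', ← Real.exp_add, ← Real.exp_add]
  apply Real.exp_le_exp.mpr
  have h1 : s ^ 3 ≤ τ ^ 3 := pow_le_pow_left₀ (hσ.le.trans hs.1.le) hs.2 3
  have h2 : -(x * s) ≤ |x| * τ := by
    have : -(x * s) ≤ |x| * s := by
      have := neg_abs_le x
      nlinarith [hs.1]
    exact this.trans (mul_le_mul_of_nonneg_left hs.2 (abs_nonneg x))
  have h3 : σ * T ^ 2 ≤ s * T ^ 2 := mul_le_mul_of_nonneg_right hs.1.le (sq_nonneg T)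
  linarith

lemma airy_bound_tendsto (C σ : ℝ) (hσ : 0 < σ) (D : ℝ) :
    Tendsto (fun T : ℝ => C * Real.exp (-σ * T ^ 2) * D) atTop (𝓝 0) := by
  have h : Tendsto (fun T : ℝ => Real.exp (-σ * T ^ 2)) atTop (𝓝 0) := by
    apply Real.tendsto_exp_atBot.comp
    exact (tendsto_pow_atTop (two_ne_zero)).const_mul_atTop_of_neg (by linarith)
  simpa using (h.const_mul C).mul_const D

lemma airy_shift (x σ τ : ℝ) (hσ : 0 < σ) (h : σ ≤ τ) :
    ∫ t : ℝ, airyK x (σ + t * I) = ∫ t : ℝ, airyK x (τ + t * I) := by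
  have hrect : ∀ T : ℝ, (∫ s : ℝ in σ..τ, airyK x (s + (-T : ℝ) * I))
      - (∫ s : ℝ in σ..τ, airyK x (s + T * I))
      + I • (∫ y : ℝ in (-T)..T, airyK x (τ + y * I))
      - I • (∫ y : ℝ in (-T)..T, airyK x (σ + y * I)) = 0 := by
    intro T
    have := Complex.integral_boundary_rect_eq_zero_of_differentiableOn (airyK x)
      ⟨σ, -T⟩ ⟨τ, T⟩ (airyK_diff x).differentiableOn
    exact this
  have h1 : Tendsto (fun T : ℝ => ∫ s : ℝ in σ..τ, airyK x (s + T * I)) atTop (𝓝 0) :=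
    squeeze_zero_norm (fun T => airy_horiz x σ τ T hσ h) (airy_bound_tendsto _ σ hσ _)
  have h2 : Tendsto (fun T : ℝ => ∫ s : ℝ in σ..τ, airyK x (s + (-T : ℝ) * I)) atTop (𝓝 0) := by
    refine squeeze_zero_norm (fun T => ?_)
      (airy_bound_tendsto (Real.exp (τ ^ 3 / 3 + |x| * τ)) σ hσ (|τ - σ|))
    have := airy_horiz x σ τ (-T) hσ h
    rwa [neg_sq] at this
  have h3 := intervalIntegral_tendsto_integral (airyK_int x τ (hσ.trans_le h))
    tendsto_neg_atTop_atBot tendsto_id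
  have h4 := intervalIntegral_tendsto_integral (airyK_int x σ hσ)
    tendsto_neg_atTop_atBot tendsto_id
  have h5 := ((h2.sub h1).add (h3.const_smul I)).sub (h4.const_smul I)
  have h6 := tendsto_nhds_unique (h5.congr hrect) tendsto_const_nhds
  simp only [smul_eq_mul, sub_zero, zero_add] at h6
  rw [← mul_sub] at h6
  have h7 := (mul_eq_zero.mp h6).resolve_left I_ne_zero
  exact (sub_eq_zero.mp h7).symm

lemma Ai_eq (x σ : ℝ) (hσ : 0 < σ) :
    Ai x = ((2 * Real.pi : ℝ) : ℂ)⁻¹ * ∫ t : ℝ, airyK x (σ + t * I) := by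
  have h1 : Ai x = ((2 * Real.pi : ℝ) : ℂ)⁻¹ * ∫ t : ℝ, airyK x ((1 : ℝ) + t * I) := by
    simp [Ai, airyK]
  rw [h1]
  rcases le_total σ 1 with h | h
  · rw [airy_shift x σ 1 hσ h]
  · rw [airy_shift x 1 σ one_pos h]

lemma Ai_bound (σ : ℝ) (hσ : 0 < σ) :
    ∃ C : ℝ, 0 ≤ C ∧ ∀ x : ℝ, ‖Ai x‖ ≤ C * Real.exp (-(σ * x)) := by
  refine ⟨(2 * Real.pi)⁻¹ * (Real.exp (σ ^ 3 / 3) * ∫ t : ℝ, Real.exp (-σ * t ^ 2)), ?_, ?_⟩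
  · have : 0 ≤ ∫ t : ℝ, Real.exp (-σ * t ^ 2) := integral_nonneg fun t => (Real.exp_pos _).le
    have := Real.pi_pos
    positivity
  · intro x
    rw [Ai_eq x σ hσ, norm_mul, norm_inv, Complex.norm_real,
      Real.norm_of_nonneg (by positivity : 0 ≤ 2 * Real.pi), mul_assoc]
    refine mul_le_mul_of_nonneg_left ?_ (by positivity)
    refine (norm_integral_le_integral_norm _).trans (le_of_eq ?_)
    simp_rw [airyK_norm']
    rw [integral_const_mul, sub_eq_add_neg, Real.exp_add, mul_comm x σ]
    ring

lemma integrable_exp_abs (c : ℝ) (hc : 0 < c) :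
    Integrable (fun x : ℝ => Real.exp (-(c * |x|))) := by
  rw [← integrableOn_univ, ← Set.Iic_union_Ioi (a := (0 : ℝ))]
  refine IntegrableOn.union ?_ ?_
  · refine (integrableOn_exp_mul_Iic hc 0).congr_fun (fun x hx => ?_) measurableSet_Iic
    simp only [abs_of_nonpos (Set.mem_Iic.mp hx)]
    congr 1
    ring
  · refine (integrableOn_exp_mul_Ioi (neg_lt_zero.mpr hc) 0).congr_fun (fun x hx => ?_)
      measurableSet_Ioi
    simp only [abs_of_pos (Set.mem_Ioi.mp hx)]
    congr 1
    ring

open FourierTransform in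
lemma Ai_fourier (z : ℂ) (hz : 0 < z.re) (x : ℝ) :
    Complex.exp (z * ((2 * Real.pi * x : ℝ) : ℂ)) * Ai ((2 * Real.pi * x : ℝ) : ℂ)
      = ((2 * Real.pi : ℝ) : ℂ)⁻¹ * (Complex.exp (↑(2 * Real.pi * (x * z.im)) * I) *
        𝓕 (fun t : ℝ => airyK 0 (z.re + t * I)) x) := by
  rw [Ai_eq _ z.re hz, Real.fourier_real_eq_integral_exp_smul, mul_left_comm]
  congr 1
  rw [← integral_const_mul (Complex.exp (z * _)), ← integral_const_mul (Complex.exp (_ * I))]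
  refine integral_congr_ae (ae_of_all _ fun t => ?_)
  simp only [airyK, smul_eq_mul]
  rw [← Complex.exp_add, ← Complex.exp_add, ← Complex.exp_add]
  congr 1
  nth_rewrite 1 [← Complex.re_add_im z]
  push_cast
  ring

/-- for every `z` with `Re z > 0`, `∫_ℝ e^{zt} Ai(t) dt` converges absolutely
and equals `e^{z³/3}`. -/
theorem Ai_laplace_transform :
    ∀ z : ℂ, 0 < z.re →
      Integrable (fun t : ℝ => Complex.exp (z * (t : ℂ)) * Ai t) ∧
      ∫ t : ℝ, Complex.exp (z * (t : ℂ)) * Ai t = Complex.exp (z ^ 3 / 3) := by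
  intro z hz
  have hpi : (0 : ℝ) < 2 * Real.pi := by positivity
  have hpi' : ((2 * Real.pi : ℝ) : ℂ) ≠ 0 := by exact_mod_cast hpi.ne'
  set g : ℝ → ℂ := fun t : ℝ => airyK 0 (z.re + t * I) with hg
  have hgi : Integrable g := airyK_int 0 z.re hz
  have hgc : Continuous g := airyK_cont 0 z.re
  have hFc : Continuous (FourierTransform.fourier g) :=
    VectorFourier.fourierIntegral_continuous Real.continuous_fourierChar
      (by exact continuous_inner) hgi
  set h : ℝ → ℂ := fun t : ℝ => Complex.exp (z * (t : ℂ)) * Ai t with hh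
  have key : ∀ x : ℝ, h (2 * Real.pi * x) = ((2 * Real.pi : ℝ) : ℂ)⁻¹ *
      (Complex.exp (↑(2 * Real.pi * (x * z.im)) * I) * FourierTransform.fourier g x) :=
    fun x => Ai_fourier z hz x
  have hc : Continuous h := by
    have h1 : Continuous (fun x : ℝ => h (2 * Real.pi * x)) := by
      simp_rw [key]
      fun_prop
    have h2 : h = (fun x : ℝ => h (2 * Real.pi * x)) ∘ (fun y => y / (2 * Real.pi)) := by
      ext y
      simp only [Function.comp]
      congr 1
      field_simp
    rw [h2]
    exact h1.comp (by fun_prop)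
  have hint : Integrable h := by
    obtain ⟨C₁, hC₁, hb₁⟩ := Ai_bound (z.re / 2) (by linarith)
    obtain ⟨C₂, hC₂, hb₂⟩ := Ai_bound (3 * z.re / 2) (by linarith)
    refine Integrable.mono' ((integrable_exp_abs (z.re / 2) (by linarith)).const_mul (C₁ + C₂))
      hc.aestronglyMeasurable ?_
    filter_upwards with x
    have hn : ‖h x‖ = Real.exp (z.re * x) * ‖Ai x‖ := by
      simp [hh, Complex.norm_exp]
    rw [hn]
    rcases le_total x 0 with hx | hx
    · calc Real.exp (z.re * x) * ‖Ai x‖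
          ≤ Real.exp (z.re * x) * (C₁ * Real.exp (-(z.re / 2 * x))) :=
            mul_le_mul_of_nonneg_left (hb₁ x) (Real.exp_pos _).le
        _ = C₁ * Real.exp (-(z.re / 2 * |x|)) := by
            rw [mul_left_comm, ← Real.exp_add, abs_of_nonpos hx]
            congr 2
            ring
        _ ≤ _ := mul_le_mul_of_nonneg_right (by linarith) (Real.exp_pos _).le
    · calc Real.exp (z.re * x) * ‖Ai x‖
          ≤ Real.exp (z.re * x) * (C₂ * Real.exp (-(3 * z.re / 2 * x))) :=
            mul_le_mul_of_nonneg_left (hb₂ x) (Real.exp_pos _).le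
        _ = C₂ * Real.exp (-(z.re / 2 * |x|)) := by
            rw [mul_left_comm, ← Real.exp_add, abs_of_nonneg hx]
            congr 2
            ring
        _ ≤ _ := mul_le_mul_of_nonneg_right (by linarith) (Real.exp_pos _).le
  refine ⟨hint, ?_⟩
  have hFi : Integrable (FourierTransform.fourier g) := by
    refine Integrable.mono' (((hint.comp_mul_left' hpi.ne').norm).const_mul (2 * Real.pi))
      hFc.aestronglyMeasurable ?_
    filter_upwards with x
    rw [key, norm_mul, norm_mul, Complex.norm_exp_ofReal_mul_I, norm_inv, Complex.norm_real,
      Real.norm_of_nonneg hpi.le, one_mul, ← mul_assoc, mul_inv_cancel₀ hpi.ne', one_mul]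
  have hinv := hgi.fourierInv_fourier_eq hFi (v := z.im) hgc.continuousAt
  rw [Real.fourierInv_eq'] at hinv
  have hsub := Measure.integral_comp_mul_left h (2 * Real.pi)
  simp_rw [key] at hsub
  rw [integral_const_mul] at hsub
  have hinv' : ∫ x : ℝ, Complex.exp (↑(2 * Real.pi * (x * z.im)) * I) *
      FourierTransform.fourier g x = g z.im := by
    rw [← hinv]
    congr 1
    ext x
    simp [mul_comm]
  rw [hinv', abs_of_pos (inv_pos.mpr hpi), Complex.real_smul, Complex.ofReal_inv] at hsub
  have := mul_left_cancel₀ (inv_ne_zero hpi') hsub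
  rw [← this]
  simp [hg, airyK, Complex.re_add_im]
end
end

section
/- For every fixed real p ≥ 1 there exists a constant C > 0 such that for all real a ≥ 0: ∫₀^∞ x^{p−1}·|Ai(x − a)| dx ≤ C·(a^{p−1/4} + 1) and ∫₀^∞ x^{p−1}·Ai(x − a)² dx ≤ C·(a^{p−1/2} + 1). -/
open MeasureTheory ProbabilityTheory Complex Filter Topology

noncomputable section

def aiF (n : ℕ) (s t : ℝ) : ℂ :=
  (1 + t * Complex.I) ^ n * Complex.exp ((1 + t * Complex.I) ^ 3 / 3 + s * (1 + t * Complex.I))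

lemma aiF_cont (n : ℕ) (s : ℝ) : Continuous (aiF n s) := by
  unfold aiF; fun_prop

lemma aiF_norm_zero (s t : ℝ) : ‖aiF 0 s t‖ = Real.exp (1/3 + s) * Real.exp (-t^2) := by
  unfold aiF
  rw [pow_zero, one_mul, Complex.norm_exp, ← Real.exp_add]
  congr 1
  have : ((1 + (t:ℂ) * Complex.I) ^ 3 / 3 + s * (1 + t * Complex.I)) 
     = ((1/3 - t^2 + s : ℝ) : ℂ) + ((t - t^3/3 + s * t : ℝ) : ℂ) * Complex.I := by
    have hI : Complex.I ^ 3 = - Complex.I := Complex.I_pow_three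
    push_cast
    ring_nf
    rw [hI, Complex.I_sq]; ring
  rw [this]
  simp only [Complex.add_re, Complex.ofReal_re, Complex.re_ofReal_mul, Complex.I_re]
  ring

lemma aiF_norm_le (n : ℕ) (hn : n ≤ 2) (s t : ℝ) :
    ‖aiF n s t‖ ≤ 2 * Real.exp (1/3 + s) * Real.exp (-(1/2) * t^2) := by
  have h0 : ‖aiF n s t‖ = ‖(1 + (t:ℂ) * Complex.I)‖ ^ n * ‖aiF 0 s t‖ := by
    simp [aiF]
  rw [h0, aiF_norm_zero]
  have h1 : ‖(1 + (t:ℂ) * Complex.I)‖ ^ 2 = 1 + t^2 := by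
    rw [← Complex.normSq_eq_norm_sq, Complex.normSq_apply]
    simp; ring
  have h2 : 1 ≤ ‖(1 + (t:ℂ) * Complex.I)‖ := by
    by_contra h
    push Not at h
    nlinarith [norm_nonneg (1 + (t:ℂ) * Complex.I), sq_nonneg t]
  have h3 : ‖(1 + (t:ℂ) * Complex.I)‖ ^ n ≤ 1 + t^2 := by
    rw [← h1]; exact pow_le_pow_right₀ h2 hn
  have h4 : 1 + t^2 ≤ 2 * Real.exp (1/2 * t^2) := by
    have := Real.add_one_le_exp (1/2 * t^2); nlinarith [sq_nonneg t]
  have h5 : Real.exp (-(1/2) * t^2) = Real.exp (1/2 * t^2) * Real.exp (-t^2) := by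
    rw [← Real.exp_add]; congr 1; ring
  rw [h5]
  calc _ ≤ (2 * Real.exp (1/2 * t^2)) * (Real.exp (1/3 + s) * Real.exp (-t^2)) := by
        gcongr; exact h3.trans h4
    _ = _ := by ring

lemma gauss_int (c : ℝ) : Integrable (fun t : ℝ => c * Real.exp (-(1/2) * t^2)) :=
  (integrable_exp_neg_mul_sq (by norm_num)).const_mul c

lemma aiF_int (n : ℕ) (hn : n ≤ 2) (s : ℝ) : Integrable (aiF n s) :=
  (gauss_int (2 * Real.exp (1/3 + s))).mono' (aiF_cont n s).aestronglyMeasurable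
    (Eventually.of_forall (aiF_norm_le n hn s))

lemma aiF_deriv (n : ℕ) (hn : n ≤ 1) (s : ℝ) :
    HasDerivAt (fun s => ∫ t, aiF n s t) (∫ t, aiF (n+1) s t) s := by
  refine (hasDerivAt_integral_of_dominated_loc_of_deriv_le (F := aiF n) (F' := aiF (n+1))
    (bound := fun t => 2 * Real.exp (1/3 + (s+1)) * Real.exp (-(1/2) * t^2))
    (s := Metric.ball s 1) (Metric.ball_mem_nhds s one_pos) ?_ (aiF_int n (by omega) s) ?_ ?_ (gauss_int _) ?_).2
  · exact Eventually.of_forall fun x => (aiF_cont n x).aestronglyMeasurable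
  · exact (aiF_cont _ s).aestronglyMeasurable
  · refine Eventually.of_forall fun t x hx => (aiF_norm_le (n+1) (by omega) x t).trans ?_
    have : x ≤ s + 1 := by
      rw [Metric.mem_ball, Real.dist_eq, abs_lt] at hx; linarith [hx.2]
    gcongr
  · refine Eventually.of_forall fun t x _ => ?_
    unfold aiF
    have h1 : HasDerivAt (fun x : ℝ => (1 + (t:ℂ) * Complex.I) ^ 3 / 3 + (x:ℂ) * (1 + t * Complex.I))
        (1 * (1 + t * Complex.I)) x :=
      ((Complex.ofRealCLM.hasDerivAt (x := x)).mul_const _).const_add _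
    convert! h1.cexp.const_mul ((1 + (t:ℂ) * Complex.I) ^ n) using 1
    ring

lemma aiF_two (s : ℝ) : ∫ t, aiF 2 s t = - s * ∫ t, aiF 0 s t := by
  have h : ∫ t, (Complex.I * (aiF 2 s t + s * aiF 0 s t)) = 0 := by
    refine integral_eq_zero_of_hasDerivAt_of_integrable (f := aiF 0 s) ?_ ?_ (aiF_int 0 (by omega) s)
    · intro t
      unfold aiF
      have hw : HasDerivAt (fun t : ℝ => 1 + (t:ℂ) * Complex.I) (1 * Complex.I) t :=
        ((Complex.ofRealCLM.hasDerivAt (x := t)).mul_const _).const_add _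
      have := (((hw.pow 3).div_const 3).add (hw.const_mul (s:ℂ))).cexp
      simp only [pow_zero, one_mul]
      convert! this using 1
      simp
      ring
    · exact ((aiF_int 2 le_rfl s).add ((aiF_int 0 (by omega) s).const_mul _)).const_mul _
  rw [integral_const_mul, integral_add (aiF_int 2 le_rfl s) ((aiF_int 0 (by omega) s).const_mul _),
    integral_const_mul] at h
  have h2 := (mul_eq_zero.1 h).resolve_left Complex.I_ne_zero
  linear_combination h2

lemma Ai_neg (s : ℝ) : Ai (-(s:ℂ)) = ((2 * Real.pi : ℝ) : ℂ)⁻¹ * ∫ t, aiF 0 s t := by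
  unfold Ai aiF
  simp

/-- Energy estimate for real solutions of `y'' = - s y`. -/
lemma ode_bound (y z : ℝ → ℝ) (hy : ∀ s, HasDerivAt y (z s) s)
    (hz : ∀ s, HasDerivAt z (-s * y s) s) :
    ∃ K : ℝ, 0 ≤ K ∧ ∀ s, 1 ≤ s → y s ^ 2 ≤ K * s ^ (-(1/2) : ℝ) := by
  set E : ℝ → ℝ := fun s => s ^ ((1/2):ℝ) * y s ^ 2 + s ^ (-(1/2):ℝ) * z s ^ 2
    + 1/2 * s ^ (-(3/2):ℝ) * (y s * z s) with hE
  set G : ℝ → ℝ := fun s => E s * Real.exp (1/3 * s ^ (-(3/2):ℝ)) with hG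
  have key : ∀ s : ℝ, 1 ≤ s → |y s * z s| ≤ 1/2 * (s ^ ((1/2):ℝ) * y s ^ 2 + s ^ (-(1/2):ℝ) * z s ^ 2) := by
    intro s hs
    have hs0 : 0 < s := by linarith
    have h1 : s ^ (-(1/2):ℝ) = (s ^ ((1/2):ℝ))⁻¹ := Real.rpow_neg hs0.le _
    have h2 : 0 < s ^ ((1/4):ℝ) := Real.rpow_pos_of_pos hs0 _
    have h3 : s ^ ((1/2):ℝ) = (s ^ ((1/4):ℝ))^2 := by
      rw [← Real.rpow_natCast, ← Real.rpow_mul hs0.le]; norm_num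
    rw [h1, h3]
    set r := s ^ ((1/4):ℝ)
    have h4 : y s * z s = (r * y s) * (r⁻¹ * z s) := by field_simp
    rw [h4, ← inv_pow, ← mul_pow, ← mul_pow, abs_le]
    constructor <;> nlinarith [sq_nonneg (r * y s - r⁻¹ * z s), sq_nonneg (r * y s + r⁻¹ * z s)]
  have lower : ∀ s : ℝ, 1 ≤ s → 3/4 * (s ^ ((1/2):ℝ) * y s ^ 2 + s ^ (-(1/2):ℝ) * z s ^ 2) ≤ E s := by
    intro s hs
    have k := key s hs
    have h1 : s ^ (-(3/2):ℝ) ≤ 1 := Real.rpow_le_one_of_one_le_of_nonpos hs (by norm_num)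
    have h0 : 0 ≤ s ^ (-(3/2):ℝ) := Real.rpow_nonneg (by linarith) _
    have := neg_abs_le (y s * z s)
    have h5 : - |y s * z s| ≤ s ^ (-(3/2):ℝ) * (y s * z s) := by
      nlinarith [abs_nonneg (y s * z s)]
    simp only [hE]
    nlinarith
  have dE : ∀ s : ℝ, 1 ≤ s → HasDerivAt E (-(3/4) * s ^ (-(5/2):ℝ) * (y s * z s)) s := by
    intro s hs
    have hs0 : 0 < s := by linarith
    have d (r : ℝ) : HasDerivAt (fun s : ℝ => s ^ r) (r * s ^ (r-1)) s :=
      Real.hasDerivAt_rpow_const (Or.inl hs0.ne')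
    have := (((d (1/2)).mul ((hy s).pow 2)).add ((d (-(1/2))).mul ((hz s).pow 2))).add
      (((d (-(3/2))).const_mul (1/2)).mul ((hy s).mul (hz s)))
    convert! this using 1
    have e1 : s ^ ((1/2:ℝ) - 1) = s * (s ^ (-(3/2):ℝ)) := by
      rw [← Real.rpow_one_add' hs0.le (by norm_num)]; norm_num
    have e2 : s ^ (-(1/2:ℝ) - 1) = (s ^ (-(3/2):ℝ)) := by norm_num
    have e3 : s ^ (-(3/2:ℝ) - 1) = (s ^ (-(5/2):ℝ)) := by norm_num
    have e4 : s ^ ((1/2:ℝ)) = s * s * (s ^ (-(3/2):ℝ)) := by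
      rw [mul_assoc, ← Real.rpow_one_add' hs0.le (by norm_num), ← Real.rpow_one_add' hs0.le (by norm_num)]; norm_num
    have e5 : s ^ (-(1/2:ℝ)) = s * (s ^ (-(3/2):ℝ)) := by
      rw [← Real.rpow_one_add' hs0.le (by norm_num)]; norm_num
    simp only [e1, e2, e3, Pi.pow_apply, Pi.mul_apply]
    rw [e4, e5]
    push_cast
    ring
  have dG : ∀ s : ℝ, 1 ≤ s → HasDerivAt G
      ((-(3/4) * s ^ (-(5/2):ℝ) * (y s * z s) - 1/2 * s ^ (-(5/2):ℝ) * E s) * Real.exp (1/3 * s ^ (-(3/2):ℝ))) s := by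
    intro s hs
    have hs0 : 0 < s := by linarith
    have d : HasDerivAt (fun s : ℝ => s ^ (-(3/2):ℝ)) (-(3/2) * s ^ (-(3/2:ℝ)-1)) s :=
      Real.hasDerivAt_rpow_const (Or.inl hs0.ne')
    convert! (dE s hs).mul (d.const_mul (1/3)).exp using 1
    have e3 : s ^ (-(3/2:ℝ) - 1) = (s ^ (-(5/2):ℝ)) := by norm_num
    rw [e3]; ring
  have anti : AntitoneOn G (Set.Ici 1) := by
    refine antitoneOn_of_deriv_nonpos (convex_Ici 1)
      (fun s hs => (dG s hs).continuousAt.continuousWithinAt) ?_ ?_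
    · intro s hs
      rw [interior_Ici] at hs
      exact (dG s (le_of_lt hs)).differentiableAt.differentiableWithinAt
    · intro s hs
      rw [interior_Ici] at hs
      have hs : 1 ≤ s := le_of_lt hs
      rw [(dG s hs).deriv]
      refine mul_nonpos_of_nonpos_of_nonneg ?_ (Real.exp_pos _).le
      have h0 : 0 ≤ s ^ (-(5/2):ℝ) := Real.rpow_nonneg (by linarith) _
      have k := key s hs
      have l := lower s hs
      have := neg_abs_le (y s * z s)
      have : 0 ≤ s ^ (-(5/2):ℝ) * (3/4 * (y s * z s) + 1/2 * E s) := by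
        apply mul_nonneg h0; nlinarith
      linarith
  have Enn : ∀ s : ℝ, 1 ≤ s → s ^ ((1/2):ℝ) * y s ^ 2 ≤ 4/3 * E s := by
    intro s hs
    have := lower s hs
    have : 0 ≤ s ^ (-(1/2):ℝ) * z s ^ 2 := mul_nonneg (Real.rpow_nonneg (by linarith) _) (sq_nonneg _)
    linarith
  refine ⟨4/3 * G 1, ?_, ?_⟩
  · have := Enn 1 le_rfl
    have h2 : 0 ≤ E 1 := by
      have : 0 ≤ (1:ℝ) ^ ((1/2):ℝ) * y 1 ^ 2 := by positivity
      linarith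
    have : 0 ≤ G 1 := mul_nonneg h2 (Real.exp_pos _).le
    linarith
  · intro s hs
    have hs0 : 0 < s := by linarith
    have h1 : G s ≤ G 1 := anti (Set.mem_Ici.2 le_rfl) hs hs
    have h2 := Enn s hs
    have hp : 0 < s ^ ((1/2):ℝ) := Real.rpow_pos_of_pos hs0 _
    have h3 : 0 ≤ E s := by
      have : 0 ≤ s ^ ((1/2):ℝ) * y s ^ 2 := by positivity
      linarith
    have h4 : E s ≤ G s := by
      refine le_mul_of_one_le_right h3 (Real.one_le_exp ?_)
      positivity
    rw [Real.rpow_neg hs0.le, ← div_eq_mul_inv, le_div_iff₀ hp]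
    linarith

lemma Ai_norm_le_exp : ∃ K : ℝ, 0 ≤ K ∧ ∀ s : ℝ, ‖Ai (-(s:ℂ))‖ ≤ K * Real.exp s := by
  refine ⟨‖((2 * Real.pi : ℝ) : ℂ)⁻¹‖ * ((2 * Real.exp (1/3)) * ∫ t : ℝ, Real.exp (-(1/2) * t^2)), ?_, ?_⟩
  · have : 0 ≤ ∫ t : ℝ, Real.exp (-(1/2) * t^2) := integral_nonneg fun t => (Real.exp_pos _).le
    positivity
  · intro s
    rw [Ai_neg, norm_mul]
    have : ‖∫ t, aiF 0 s t‖ ≤ ∫ t : ℝ, 2 * Real.exp (1/3 + s) * Real.exp (-(1/2) * t^2) :=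
      norm_integral_le_of_norm_le (gauss_int _) (Eventually.of_forall (aiF_norm_le 0 (by omega) s))
    rw [integral_const_mul, Real.exp_add] at this
    calc _ ≤ _ := mul_le_mul_of_nonneg_left this (norm_nonneg _)
      _ = _ := by ring

lemma Ai_sq_decay : ∃ K : ℝ, 0 ≤ K ∧ ∀ s : ℝ, 1 ≤ s → ‖Ai (-(s:ℂ))‖ ^ 2 ≤ K * s ^ (-(1/2) : ℝ) := by
  set c : ℂ := ((2 * Real.pi : ℝ) : ℂ)⁻¹
  have h0 : ∀ s : ℝ, HasDerivAt (fun s : ℝ => Ai (-(s:ℂ))) (c * ∫ t, aiF 1 s t) s := by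
    intro s
    have := (aiF_deriv 0 (by omega) s).const_mul c
    simpa only [Ai_neg] using this
  have h1 : ∀ s : ℝ, HasDerivAt (fun s : ℝ => c * ∫ t, aiF 1 s t) ((-s : ℝ) * Ai (-(s:ℂ))) s := by
    intro s
    have := (aiF_deriv 1 (by omega) s).const_mul c
    convert! this using 1
    rw [Ai_neg, aiF_two, Complex.ofReal_neg]; ring
  have re {f : ℝ → ℂ} {f' : ℂ} {s : ℝ} (h : HasDerivAt f f' s) :
      HasDerivAt (fun s => (f s).re) f'.re s := 
    (Complex.reCLM.hasFDerivAt.comp_hasDerivAt s h)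
  have im {f : ℝ → ℂ} {f' : ℂ} {s : ℝ} (h : HasDerivAt f f' s) :
      HasDerivAt (fun s => (f s).im) f'.im s := 
    (Complex.imCLM.hasFDerivAt.comp_hasDerivAt s h)
  obtain ⟨K1, hK1, b1⟩ := ode_bound _ _ (fun s => re (h0 s)) (fun s => by
    have := re (h1 s); rwa [Complex.re_ofReal_mul] at this)
  obtain ⟨K2, hK2, b2⟩ := ode_bound _ _ (fun s => im (h0 s)) (fun s => by
    have := im (h1 s); rwa [Complex.im_ofReal_mul] at this)
  refine ⟨K1 + K2, by positivity, fun s hs => ?_⟩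
  rw [← Complex.normSq_eq_norm_sq, Complex.normSq_apply]
  have := b1 s hs
  have := b2 s hs
  nlinarith

lemma Ai_bounds : ∃ K : ℝ, 0 < K ∧ (∀ x : ℝ, 0 ≤ x → ‖Ai (x:ℂ)‖ ≤ K * Real.exp (-x)) ∧
    (∀ s : ℝ, 0 < s → ‖Ai (-(s:ℂ))‖ ≤ K * s ^ (-(1/4) : ℝ)) := by
  obtain ⟨A, hA, hA'⟩ := Ai_norm_le_exp
  obtain ⟨B, hB, hB'⟩ := Ai_sq_decay
  refine ⟨A * Real.exp 1 + Real.sqrt B + 1, by positivity, ?_, ?_⟩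
  · intro x hx
    have := hA' (-x)
    simp only [Complex.ofReal_neg, neg_neg] at this
    refine this.trans ?_
    gcongr
    have : 1 ≤ Real.exp 1 := Real.one_le_exp (by norm_num)
    nlinarith [Real.sqrt_nonneg B]
  · intro s hs
    have hp : 0 < s ^ (-(1/4) : ℝ) := Real.rpow_pos_of_pos hs _
    rcases le_total s 1 with h | h
    · have h1 : 1 ≤ s ^ (-(1/4) : ℝ) := Real.one_le_rpow_of_pos_of_le_one_of_nonpos hs h (by norm_num)
      calc _ ≤ A * Real.exp s := hA' s
        _ ≤ A * Real.exp 1 := by gcongr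
        _ ≤ (A * Real.exp 1 + Real.sqrt B + 1) * 1 := by linarith [Real.sqrt_nonneg B]
        _ ≤ _ := by gcongr
    · have h2 : s ^ (-(1/2) : ℝ) = (s ^ (-(1/4) : ℝ))^2 := by
        rw [← Real.rpow_natCast, ← Real.rpow_mul hs.le]; norm_num
      have h3 := hB' s h
      rw [h2, ← Real.sq_sqrt hB, ← mul_pow] at h3
      have h4 := le_of_sq_le_sq h3 (by positivity)
      refine h4.trans ?_
      gcongr
      nlinarith [Real.exp_pos 1]

lemma shift_bound (p q K : ℝ) (hp : 1 ≤ p) (hq0 : 0 ≤ q) (hq : q < 1) (hK : 0 < K) (f : ℝ → ℝ)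
    (h1 : ∀ x, 0 ≤ x → f x ≤ K * Real.exp (-x))
    (h2 : ∀ s, 0 < s → f (-s) ≤ K * s ^ (-q)) :
    ∃ C : ℝ, 0 < C ∧ ∀ a : ℝ, 0 ≤ a →
      (∫⁻ x in Set.Ioi (0 : ℝ), ENNReal.ofReal (x ^ (p - 1) * f (x - a)) ≤
        ENNReal.ofReal (C * (a ^ (p - q) + 1))) := by
  have hG : 0 < Real.Gamma p := Real.Gamma_pos_of_pos (by linarith)
  have hq' : 0 < 1 - q := by linarith
  refine ⟨K / (1 - q) + K * 2 ^ (p-1) * (1 + Real.Gamma p), by positivity, fun a ha => ?_⟩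
  have first : ∫⁻ x in Set.Ioo (0 : ℝ) a, ENNReal.ofReal (x ^ (p - 1) * f (x - a)) ≤
      ENNReal.ofReal (K / (1 - q) * a ^ (p - q)) := by
    have step : ∫⁻ x in Set.Ioo (0 : ℝ) a, ENNReal.ofReal (x ^ (p - 1) * f (x - a)) ≤
        ∫⁻ x in Set.Ioc (0 : ℝ) a, ENNReal.ofReal (K * a ^ (p-1) * (a - x) ^ (-q)) := by
      refine le_trans (setLIntegral_mono' measurableSet_Ioo ?_) (lintegral_mono_set Set.Ioo_subset_Ioc_self)
      intro x hx
      apply ENNReal.ofReal_le_ofReal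
      have hh := h2 (a - x) (by linarith [hx.2])
      rw [neg_sub] at hh
      have hx0 := hx.1
      calc _ ≤ x ^ (p-1) * (K * (a - x) ^ (-q)) := by gcongr
        _ ≤ a ^ (p-1) * (K * (a - x) ^ (-q)) := by
          have : 0 ≤ (a - x) ^ (-q) := Real.rpow_nonneg (by linarith [hx.2]) _
          have := hx.2.le
          gcongr
        _ = _ := by ring
    refine step.trans ?_
    have hint : IntervalIntegrable (fun x : ℝ => (a - x) ^ (-q)) volume 0 a := by
      have := (intervalIntegral.intervalIntegrable_rpow' (a := a) (b := 0) (r := -q) (by linarith)).comp_sub_left a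
      simpa using this
    have hint2 := ((intervalIntegrable_iff_integrableOn_Ioc_of_le ha).1 hint).const_mul (K * a ^ (p-1))
    rw [← ofReal_integral_eq_lintegral_ofReal hint2]
    · apply ENNReal.ofReal_le_ofReal
      rw [integral_const_mul, ← intervalIntegral.integral_of_le ha,
        intervalIntegral.integral_comp_sub_left (fun x => x ^ (-q)) a, sub_self, sub_zero,
        integral_rpow (Or.inl (by linarith))]
      rw [Real.zero_rpow (by linarith), sub_zero]
      have : a ^ (p - q) = a ^ (p-1) * a ^ (-q+1) := by
        rw [← Real.rpow_add_of_nonneg ha (by linarith) (by linarith)]; congr 1; ring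
      rw [this]
      apply le_of_eq
      rw [show -q + 1 = 1 - q by ring]; field_simp
    · refine (ae_restrict_iff' measurableSet_Ioc).2 (Eventually.of_forall fun x hx => ?_)
      have : 0 ≤ (a - x) ^ (-q) := Real.rpow_nonneg (by linarith [hx.2]) _
      have : 0 ≤ a ^ (p-1) := Real.rpow_nonneg ha _
      positivity
  have second : ∫⁻ x in Set.Ici a, ENNReal.ofReal (x ^ (p - 1) * f (x - a)) ≤
      ENNReal.ofReal (K * 2 ^ (p-1) * (a ^ (p-1) + Real.Gamma p)) := by
    have tr : ∫⁻ x in Set.Ici a, ENNReal.ofReal (x ^ (p - 1) * f (x - a)) =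
        ∫⁻ y in Set.Ici (0:ℝ), ENNReal.ofReal ((y + a) ^ (p - 1) * f y) := by
      rw [← lintegral_indicator measurableSet_Ici, ← lintegral_indicator measurableSet_Ici,
        ← lintegral_add_right_eq_self _ a]
      congr 1
      ext y
      simp [Set.indicator]
    rw [tr, setLIntegral_congr Ioi_ae_eq_Ici.symm]
    have step : ∫⁻ y in Set.Ioi (0:ℝ), ENNReal.ofReal ((y + a) ^ (p - 1) * f y) ≤
        ∫⁻ y in Set.Ioi (0:ℝ), ENNReal.ofReal (K * 2 ^ (p-1) * (a ^ (p-1) * Real.exp (-y) + Real.exp (-y) * y ^ (p-1))) := by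
      refine setLIntegral_mono' measurableSet_Ioi fun y hy => ENNReal.ofReal_le_ofReal ?_
      have hy : 0 < y := hy
      have hb : (y + a) ^ (p-1) ≤ 2 ^ (p-1) * (a ^ (p-1) + y ^ (p-1)) := by
        have ha1 : 0 ≤ a ^ (p-1) := Real.rpow_nonneg ha _
        have hy1 : 0 ≤ y ^ (p-1) := Real.rpow_nonneg hy.le _
        rcases le_total a y with h | h
        · calc (y + a) ^ (p-1) ≤ (2 * y) ^ (p-1) := 
                Real.rpow_le_rpow (by linarith) (by linarith) (by linarith)
            _ = 2 ^ (p-1) * y ^ (p-1) := Real.mul_rpow (by norm_num) hy.le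
            _ ≤ _ := by gcongr; linarith
        · calc (y + a) ^ (p-1) ≤ (2 * a) ^ (p-1) := 
                Real.rpow_le_rpow (by linarith) (by linarith) (by linarith)
            _ = 2 ^ (p-1) * a ^ (p-1) := Real.mul_rpow (by norm_num) ha
            _ ≤ _ := by gcongr; linarith
      calc _ ≤ (y + a) ^ (p-1) * (K * Real.exp (-y)) := by
            gcongr; exact h1 y hy.le
        _ ≤ (2 ^ (p-1) * (a ^ (p-1) + y ^ (p-1))) * (K * Real.exp (-y)) := by gcongr
        _ = _ := by ring
    refine step.trans ?_
    have i1 : IntegrableOn (fun y : ℝ => a ^ (p-1) * Real.exp (-y)) (Set.Ioi 0) :=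
      (integrableOn_exp_neg_Ioi 0).const_mul _
    have i2 : IntegrableOn (fun y : ℝ => Real.exp (-y) * y ^ (p-1)) (Set.Ioi 0) :=
      Real.GammaIntegral_convergent (by linarith)
    have i3 : IntegrableOn (fun y : ℝ => K * 2 ^ (p-1) *
        (a ^ (p-1) * Real.exp (-y) + Real.exp (-y) * y ^ (p-1))) (Set.Ioi 0) :=
      (i1.add i2).const_mul _
    rw [← ofReal_integral_eq_lintegral_ofReal i3]
    · apply ENNReal.ofReal_le_ofReal
      rw [integral_const_mul]
      rw [integral_add i1 i2, integral_const_mul, integral_exp_neg_Ioi_zero,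
        ← Real.Gamma_eq_integral (by linarith), mul_one]
    · refine (ae_restrict_iff' measurableSet_Ioi).2 (Eventually.of_forall fun y hy => ?_)
      have hy : 0 < y := hy
      have : 0 ≤ a ^ (p-1) := Real.rpow_nonneg ha _
      simp only [Pi.zero_apply]
      positivity
  have hsub : Set.Ioi (0:ℝ) ⊆ Set.Ioo 0 a ∪ Set.Ici a := by
    intro x hx
    rcases lt_or_ge x a with h | h
    · exact Or.inl ⟨hx, h⟩
    · exact Or.inr h
  have hapq : 0 ≤ a ^ (p-q) := Real.rpow_nonneg ha _
  have hap : a ^ (p-1) ≤ a ^ (p-q) + 1 := by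
    rcases le_total a 1 with h | h
    · have := Real.rpow_le_one ha h (show 0 ≤ p - 1 by linarith)
      linarith
    · have := Real.rpow_le_rpow_of_exponent_le h (show p - 1 ≤ p - q by linarith)
      linarith
  have hap0 : 0 ≤ a ^ (p-1) := Real.rpow_nonneg ha _
  calc _ ≤ _ := lintegral_mono_set hsub
    _ ≤ _ := lintegral_union_le _ _ _
    _ ≤ _ := add_le_add first second
    _ = _ := (ENNReal.ofReal_add (by positivity) (by positivity)).symm
    _ ≤ _ := by
      apply ENNReal.ofReal_le_ofReal
      have e1 : K / (1 - q) * a ^ (p-q) ≤ K / (1 - q) * (a ^ (p-q) + 1) := by gcongr; linarith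
      have e2 : K * 2 ^ (p-1) * (a ^ (p-1) + Real.Gamma p) ≤
          K * 2 ^ (p-1) * ((1 + Real.Gamma p) * (a ^ (p-q) + 1)) := by
        gcongr
        nlinarith
      linarith

/-- for every real `p ≥ 1` there is `C > 0` such that for all `a ≥ 0`,
`∫₀^∞ x^{p−1} |Ai(x−a)| dx ≤ C (a^{p−1/4} + 1)` and
`∫₀^∞ x^{p−1} Ai(x−a)² dx ≤ C (a^{p−1/2} + 1)`. -/
theorem integral_Ai_shift_bound :
    ∀ p : ℝ, 1 ≤ p → ∃ C : ℝ, 0 < C ∧ ∀ a : ℝ, 0 ≤ a →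
      (∫⁻ x in Set.Ioi (0 : ℝ),
          ENNReal.ofReal (x ^ (p - 1) * ‖Ai ((x : ℂ) - (a : ℂ))‖) ≤
        ENNReal.ofReal (C * (a ^ (p - 1 / 4) + 1))) ∧
      (∫⁻ x in Set.Ioi (0 : ℝ),
          ENNReal.ofReal (x ^ (p - 1) * ‖Ai ((x : ℂ) - (a : ℂ))‖ ^ 2) ≤
        ENNReal.ofReal (C * (a ^ (p - 1 / 2) + 1))) := by
  intro p hp
  obtain ⟨K, hK, b1, b2⟩ := Ai_bounds
  obtain ⟨C1, hC1, c1⟩ := shift_bound p (1/4) K hp (by norm_num) (by norm_num) hK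
    (fun x => ‖Ai (x:ℂ)‖) b1 (fun s hs => by simpa using b2 s hs)
  obtain ⟨C2, hC2, c2⟩ := shift_bound p (1/2) (K^2) hp (by norm_num) (by norm_num) (by positivity)
    (fun x => ‖Ai (x:ℂ)‖ ^ 2) (fun x hx => by
      have h := b1 x hx
      calc ‖Ai (x:ℂ)‖ ^ 2 ≤ (K * Real.exp (-x)) ^ 2 := by gcongr
        _ = K ^ 2 * (Real.exp (-x) * Real.exp (-x)) := by ring
        _ ≤ K ^ 2 * (Real.exp (-x) * 1) := by
          gcongr
          exact Real.exp_le_one_iff.2 (by linarith)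
        _ = _ := by ring) (fun s hs => by
      have h := b2 s hs
      have h2 : s ^ (-(1/2) : ℝ) = (s ^ (-(1/4) : ℝ))^2 := by
        rw [← Real.rpow_natCast, ← Real.rpow_mul hs.le]; norm_num
      rw [h2, ← mul_pow]
      simp only [Complex.ofReal_neg]
      gcongr)
  refine ⟨C1 + C2, by positivity, fun a ha => ⟨?_, ?_⟩⟩
  · have := c1 a ha
    simp only [Complex.ofReal_sub] at this
    refine this.trans (ENNReal.ofReal_le_ofReal ?_)
    have : 0 ≤ a ^ (p - 1/4) := Real.rpow_nonneg ha _
    gcongr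
    linarith
  · have := c2 a ha
    simp only [Complex.ofReal_sub] at this
    refine this.trans (ENNReal.ofReal_le_ofReal ?_)
    have : 0 ≤ a ^ (p - 1/2) := Real.rpow_nonneg ha _
    gcongr
    linarith
end
end
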